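/- arXiv:1911.07795 — 4 statements merged into one kernel-verified Lean document; each statement's English description precedes it below -/
import Mathlib

section
/- Suppose $\tilde\psi$ satisfies $\mathcal D\tilde\psi=\frac{\hbar^2}{x-x'}\big(\partial_x\tilde\psi+\partial_{x'}\tilde\psi\big)$ at every point of $\Omega$. Then at every point of $\Omega$: $\hbar^2\,\partial_{x'}^2\tilde\psi=\hbar^2\,\partial_x^2\tilde\psi-2\,\mathcal D\tilde\psi-(x-x')\big(\partial_x(\mathcal D\tilde\psi)+\mathcal D(\partial_x\tilde\psi)\big)+\hbar^{-2}(x-x')\,\mathcal D\big((x-x')\,\mathcal D\tilde\psi\big)$, where $(x-x')\,\mathcal D\tilde\psi$ denotes the function $(x,x',t)\mapsto (x-x')\,(\mathcal D\tilde\psi)(x,x',t)$. -/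
/-- Partial derivative in the first variable. -/
noncomputable def pdx (f : ℝ → ℝ → ℝ → ℂ) : ℝ → ℝ → ℝ → ℂ :=
  fun x x' t => deriv (fun s => f s x' t) x

/-- Partial derivative in the second variable. -/
noncomputable def pdx' (f : ℝ → ℝ → ℝ → ℂ) : ℝ → ℝ → ℝ → ℂ :=
  fun x x' t => deriv (fun s => f x s t) x'

/-- Partial derivative in the third variable. -/
noncomputable def pdt (f : ℝ → ℝ → ℝ → ℂ) : ℝ → ℝ → ℝ → ℂ :=
  fun x x' t => deriv (fun s => f x x' s) t

/-- The operator `𝒟 = ℏ²∂ₓ² - ℏ²∂ₜ - R(x,t)` acting on functions of `(x,x',t)`. -/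
noncomputable def Dop (h : ℝ) (R : ℝ → ℝ → ℂ) (f : ℝ → ℝ → ℝ → ℂ) : ℝ → ℝ → ℝ → ℂ :=
  fun x x' t => (h : ℂ) ^ 2 * pdx (pdx f) x x' t - (h : ℂ) ^ 2 * pdt f x x' t
    - R x t * f x x' t

/-- Joint smoothness of a curried function of three real variables. -/
def IsSmooth₃ (f : ℝ → ℝ → ℝ → ℂ) : Prop :=
  ContDiff ℝ (⊤ : ℕ∞) (fun p : ℝ × ℝ × ℝ => f p.1 p.2.1 p.2.2)

/-- The directional derivative of a curried function of three real variables. -/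
noncomputable def dirDeriv (v : ℝ × ℝ × ℝ) (f : ℝ → ℝ → ℝ → ℂ) : ℝ → ℝ → ℝ → ℂ :=
  fun x x' t => fderiv ℝ (fun p : ℝ × ℝ × ℝ => f p.1 p.2.1 p.2.2) (x, x', t) v

namespace IsSmooth₃

variable {f g : ℝ → ℝ → ℝ → ℂ}

theorem hasFDerivAt (hf : IsSmooth₃ f) (p : ℝ × ℝ × ℝ) :
    HasFDerivAt (fun p : ℝ × ℝ × ℝ => f p.1 p.2.1 p.2.2)
      (fderiv ℝ (fun p : ℝ × ℝ × ℝ => f p.1 p.2.1 p.2.2) p) p :=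
  (hf.differentiable (by simp) p).hasFDerivAt

theorem isSmooth₃_dirDeriv (hf : IsSmooth₃ f) (v : ℝ × ℝ × ℝ) : IsSmooth₃ (dirDeriv v f) :=
  (hf.fderiv_right (m := (⊤ : ℕ∞)) (by simp)).clm_apply contDiff_const

theorem dirDeriv_comm (hf : IsSmooth₃ f) (v w : ℝ × ℝ × ℝ) :
    dirDeriv v (dirDeriv w f) = dirDeriv w (dirDeriv v f) := by
  have key : ∀ (a b : ℝ × ℝ × ℝ) (x x' t : ℝ),
      dirDeriv a (dirDeriv b f) x x' t
        = fderiv ℝ (fderiv ℝ (fun p : ℝ × ℝ × ℝ => f p.1 p.2.1 p.2.2)) (x, x', t) a b := by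
    intro a b x x' t
    have hd := ((hf.fderiv_right (m := (⊤ : ℕ∞)) (by simp)).differentiable (by simp)
      (x, x', t)).hasFDerivAt
    have h2 := (hd.clm_apply (hasFDerivAt_const b (x, x', t))).fderiv
    have h3 := congrArg (fun L => L a) h2
    simpa [dirDeriv] using h3
  funext x x' t
  rw [key, key]
  exact (ContDiff.contDiffAt hf).isSymmSndFDerivAt
    (by simpa using WithTop.coe_le_coe.mpr (le_top : (2 : ℕ∞) ≤ ⊤)) v w

theorem hasDerivAt_fst (hf : IsSmooth₃ f) (x x' t : ℝ) :
    HasDerivAt (fun s => f s x' t) (dirDeriv (1, 0, 0) f x x' t) x :=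
  HasFDerivAt.comp_hasDerivAt (l := fun p : ℝ × ℝ × ℝ => f p.1 p.2.1 p.2.2) x
    (hf.hasFDerivAt (x, x', t))
    ((hasDerivAt_id x).prodMk ((hasDerivAt_const x x').prodMk (hasDerivAt_const x t)))

theorem hasDerivAt_snd (hf : IsSmooth₃ f) (x x' t : ℝ) :
    HasDerivAt (fun s => f x s t) (dirDeriv (0, 1, 0) f x x' t) x' :=
  HasFDerivAt.comp_hasDerivAt (l := fun p : ℝ × ℝ × ℝ => f p.1 p.2.1 p.2.2) x'
    (hf.hasFDerivAt (x, x', t))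
    ((hasDerivAt_const x' x).prodMk ((hasDerivAt_id x').prodMk (hasDerivAt_const x' t)))

theorem hasDerivAt_thd (hf : IsSmooth₃ f) (x x' t : ℝ) :
    HasDerivAt (fun s => f x x' s) (dirDeriv (0, 0, 1) f x x' t) t :=
  HasFDerivAt.comp_hasDerivAt (l := fun p : ℝ × ℝ × ℝ => f p.1 p.2.1 p.2.2) t
    (hf.hasFDerivAt (x, x', t))
    ((hasDerivAt_const t x).prodMk ((hasDerivAt_const t x').prodMk (hasDerivAt_id t)))

theorem pdx_eq (hf : IsSmooth₃ f) : pdx f = dirDeriv (1, 0, 0) f := by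
  funext x x' t
  exact (hf.hasDerivAt_fst x x' t).deriv

theorem pdx'_eq (hf : IsSmooth₃ f) : pdx' f = dirDeriv (0, 1, 0) f := by
  funext x x' t
  exact (hf.hasDerivAt_snd x x' t).deriv

theorem pdt_eq (hf : IsSmooth₃ f) : pdt f = dirDeriv (0, 0, 1) f := by
  funext x x' t
  exact (hf.hasDerivAt_thd x x' t).deriv

theorem isSmooth₃_pdx (hf : IsSmooth₃ f) : IsSmooth₃ (pdx f) :=
  hf.pdx_eq ▸ hf.isSmooth₃_dirDeriv _

theorem isSmooth₃_pdx' (hf : IsSmooth₃ f) : IsSmooth₃ (pdx' f) :=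
  hf.pdx'_eq ▸ hf.isSmooth₃_dirDeriv _

theorem isSmooth₃_pdt (hf : IsSmooth₃ f) : IsSmooth₃ (pdt f) :=
  hf.pdt_eq ▸ hf.isSmooth₃_dirDeriv _

theorem hasDerivAt_pdx (hf : IsSmooth₃ f) (x x' t : ℝ) :
    HasDerivAt (fun s => f s x' t) (pdx f x x' t) x :=
  hf.pdx_eq ▸ hf.hasDerivAt_fst x x' t

theorem hasDerivAt_pdx' (hf : IsSmooth₃ f) (x x' t : ℝ) :
    HasDerivAt (fun s => f x s t) (pdx' f x x' t) x' :=
  hf.pdx'_eq ▸ hf.hasDerivAt_snd x x' t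

theorem hasDerivAt_pdt (hf : IsSmooth₃ f) (x x' t : ℝ) :
    HasDerivAt (fun s => f x x' s) (pdt f x x' t) t :=
  hf.pdt_eq ▸ hf.hasDerivAt_thd x x' t

theorem pdx'_pdx_comm (hf : IsSmooth₃ f) :
    pdx' (pdx f) = pdx (pdx' f) := by
  rw [hf.isSmooth₃_pdx.pdx'_eq, hf.isSmooth₃_pdx'.pdx_eq, hf.pdx_eq, hf.pdx'_eq, hf.dirDeriv_comm]

theorem pdx'_pdt_comm (hf : IsSmooth₃ f) :
    pdx' (pdt f) = pdt (pdx' f) := by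
  rw [hf.isSmooth₃_pdt.pdx'_eq, hf.isSmooth₃_pdx'.pdt_eq, hf.pdt_eq, hf.pdx'_eq, hf.dirDeriv_comm]

theorem pdx_const_mul_add (hf : IsSmooth₃ f) (hg : IsSmooth₃ g) (k : ℂ) :
    pdx (fun a b c => k * (f a b c + g a b c))
      = fun a b c => k * (pdx f a b c + pdx g a b c) := by
  funext x x' t
  exact (((hf.hasDerivAt_pdx x x' t).add (hg.hasDerivAt_pdx x x' t)).const_mul k).deriv

theorem pdx'_const_mul_add (hf : IsSmooth₃ f) (hg : IsSmooth₃ g) (k : ℂ) :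
    pdx' (fun a b c => k * (f a b c + g a b c))
      = fun a b c => k * (pdx' f a b c + pdx' g a b c) := by
  funext x x' t
  exact (((hf.hasDerivAt_pdx' x x' t).add (hg.hasDerivAt_pdx' x x' t)).const_mul k).deriv

theorem pdt_const_mul_add (hf : IsSmooth₃ f) (hg : IsSmooth₃ g) (k : ℂ) :
    pdt (fun a b c => k * (f a b c + g a b c))
      = fun a b c => k * (pdt f a b c + pdt g a b c) := by
  funext x x' t
  exact (((hf.hasDerivAt_pdt x x' t).add (hg.hasDerivAt_pdt x x' t)).const_mul k).deriv

theorem Dop_const_mul_add (hf : IsSmooth₃ f) (hg : IsSmooth₃ g) (h : ℝ) (R : ℝ → ℝ → ℂ) (k : ℂ)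
    (x x' t : ℝ) :
    Dop h R (fun a b c => k * (f a b c + g a b c)) x x' t
      = k * (Dop h R f x x' t + Dop h R g x x' t) := by
  simp only [Dop, hf.pdx_const_mul_add hg, hf.isSmooth₃_pdx.pdx_const_mul_add hg.isSmooth₃_pdx,
    hf.pdt_const_mul_add hg]
  ring

theorem isSmooth₃_Dop (hf : IsSmooth₃ f) (h : ℝ) {R : ℝ → ℝ → ℂ}
    (hR : ContDiff ℝ (⊤ : ℕ∞) (fun p : ℝ × ℝ => R p.1 p.2)) : IsSmooth₃ (Dop h R f) := by
  have hRf : ContDiff ℝ (⊤ : ℕ∞) (fun p : ℝ × ℝ × ℝ => R p.1 p.2.2) :=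
    hR.comp (contDiff_fst.prodMk (contDiff_snd.comp contDiff_snd))
  exact ((contDiff_const.mul hf.isSmooth₃_pdx.isSmooth₃_pdx).sub
    (contDiff_const.mul hf.isSmooth₃_pdt)).sub (hRf.mul hf)

/-- `𝒟` has coefficients independent of `x'`, so it commutes with `∂_{x'}`. -/
theorem pdx'_Dop (hf : IsSmooth₃ f) (h : ℝ) (R : ℝ → ℝ → ℂ) (x x' t : ℝ) :
    pdx' (Dop h R f) x x' t = Dop h R (pdx' f) x x' t := by
  have hd :=
    ((((hf.isSmooth₃_pdx.isSmooth₃_pdx.hasDerivAt_pdx' x x' t).const_mul ((h : ℂ) ^ 2)).sub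
    ((hf.isSmooth₃_pdt.hasDerivAt_pdx' x x' t).const_mul ((h : ℂ) ^ 2))).sub
    ((hf.hasDerivAt_pdx' x x' t).const_mul (R x t))).deriv
  rw [hf.isSmooth₃_pdx.pdx'_pdx_comm, hf.pdx'_pdx_comm, hf.pdx'_pdt_comm] at hd
  exact hd

end IsSmooth₃

section OffDiagonal

variable {f g : ℝ → ℝ → ℝ → ℂ}

theorem pdx_congr_off_diagonal (hfg : ∀ x x' t : ℝ, x ≠ x' → f x x' t = g x x' t)
    (x x' t : ℝ) (hx : x ≠ x') : pdx f x x' t = pdx g x x' t :=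
  Filter.EventuallyEq.deriv_eq
    ((eventually_ne_nhds hx).mono fun s hs => hfg s x' t hs)

theorem pdx'_congr_off_diagonal (hfg : ∀ x x' t : ℝ, x ≠ x' → f x x' t = g x x' t)
    (x x' t : ℝ) (hx : x ≠ x') : pdx' f x x' t = pdx' g x x' t :=
  Filter.EventuallyEq.deriv_eq
    ((eventually_ne_nhds hx.symm).mono fun s hs => hfg x s t hs.symm)

theorem Dop_congr_off_diagonal (hfg : ∀ x x' t : ℝ, x ≠ x' → f x x' t = g x x' t)
    (h : ℝ) (R : ℝ → ℝ → ℂ) (x x' t : ℝ) (hx : x ≠ x') :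
    Dop h R f x x' t = Dop h R g x x' t := by
  have hpdt : pdt f x x' t = pdt g x x' t := congrArg (fun u => deriv u t)
    (funext fun s => hfg x x' s hx)
  rw [Dop, Dop, hpdt, hfg x x' t hx,
    pdx_congr_off_diagonal (pdx_congr_off_diagonal hfg) x x' t hx]

end OffDiagonal

theorem IsSmooth₃.pdx_sub_mul {f : ℝ → ℝ → ℝ → ℂ} (hf : IsSmooth₃ f) (x x' t : ℝ) :
    pdx (fun a b c => ((a : ℂ) - (b : ℂ)) * f a b c) x x' t
      = f x x' t + ((x : ℂ) - (x' : ℂ)) * pdx f x x' t := by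
  have hd := (((hasDerivAt_id x).ofReal_comp.sub_const (x' : ℂ)).mul
    (hf.hasDerivAt_pdx x x' t)).deriv
  exact hd.trans (by simp)

theorem IsSmooth₃.pdx'_sub_mul {f : ℝ → ℝ → ℝ → ℂ} (hf : IsSmooth₃ f) (x x' t : ℝ) :
    pdx' (fun a b c => ((a : ℂ) - (b : ℂ)) * f a b c) x x' t
      = -f x x' t + ((x : ℂ) - (x' : ℂ)) * pdx' f x x' t := by
  have hd := (((hasDerivAt_id x').ofReal_comp.const_sub (x : ℂ)).mul
    (hf.hasDerivAt_pdx' x x' t)).deriv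
  exact hd.trans (by simp)

theorem stmt1 (h : ℝ) (hh : h ≠ 0)
    (R : ℝ → ℝ → ℂ) (hR : ContDiff ℝ (⊤ : ℕ∞) (fun p : ℝ × ℝ => R p.1 p.2))
    (ψ : ℝ → ℝ → ℝ → ℂ) (hψ : ContDiff ℝ (⊤ : ℕ∞) (fun p : ℝ × ℝ × ℝ => ψ p.1 p.2.1 p.2.2))
    (hpde : ∀ x x' t : ℝ, x ≠ x' →
      Dop h R ψ x x' t = (h : ℂ) ^ 2 / ((x : ℂ) - (x' : ℂ)) * (pdx ψ x x' t + pdx' ψ x x' t)) :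
    ∀ x x' t : ℝ, x ≠ x' →
      (h : ℂ) ^ 2 * pdx' (pdx' ψ) x x' t
        = (h : ℂ) ^ 2 * pdx (pdx ψ) x x' t - 2 * Dop h R ψ x x' t
          - ((x : ℂ) - (x' : ℂ)) * (pdx (Dop h R ψ) x x' t + Dop h R (pdx ψ) x x' t)
          + ((h : ℂ) ^ 2)⁻¹ * ((x : ℂ) - (x' : ℂ))
            * Dop h R (fun a b c => ((a : ℂ) - (b : ℂ)) * Dop h R ψ a b c) x x' t := by
  have hs : IsSmooth₃ ψ := hψ
  have hD : IsSmooth₃ (Dop h R ψ) := hs.isSmooth₃_Dop h hR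
  have hk : (h : ℂ) ^ 2 ≠ 0 := pow_ne_zero 2 (Complex.ofReal_ne_zero.mpr hh)
  have hmul : ∀ x x' t : ℝ, x ≠ x' → ((x : ℂ) - (x' : ℂ)) * Dop h R ψ x x' t
      = (h : ℂ) ^ 2 * (pdx ψ x x' t + pdx' ψ x x' t) := by
    intro x x' t hx
    have hne : (x : ℂ) - (x' : ℂ) ≠ 0 := sub_ne_zero.mpr (Complex.ofReal_injective.ne hx)
    rw [hpde x x' t hx]
    field_simp
  intro x x' t hx
  have e1 := pdx_congr_off_diagonal hmul x x' t hx
  have e2 := pdx'_congr_off_diagonal hmul x x' t hx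
  rw [hD.pdx_sub_mul, hs.isSmooth₃_pdx.pdx_const_mul_add hs.isSmooth₃_pdx'] at e1
  rw [hD.pdx'_sub_mul, hs.isSmooth₃_pdx.pdx'_const_mul_add hs.isSmooth₃_pdx', hs.pdx'_pdx_comm,
    hs.pdx'_Dop] at e2
  rw [Dop_congr_off_diagonal hmul h R x x' t hx,
    hs.isSmooth₃_pdx.Dop_const_mul_add hs.isSmooth₃_pdx', mul_right_comm, ← mul_assoc, inv_mul_cancel₀ hk]
  linear_combination e1 - e2
end

section
/- Given $U\in A$, define over $A[x]$ the Painlev\'e I Lax matrices $\mathcal L=\begin{pmatrix}\frac{\hbar}{2}dU & x-U\\ (x-U)(x+2U)+\frac{\hbar^2}{2}d^2U & -\frac{\hbar}{2}dU\end{pmatrix}$ and $\mathcal R=\begin{pmatrix}0 & 1\\ x+2U & 0\end{pmatrix}$. Then the zero-curvature equation $\hbar\,d\mathcal L-\hbar\,\partial_x\mathcal R+[\mathcal L,\mathcal R]=0$ holds in $M_2(A[x])$ if and only if $\hbar\cdot\Big(\frac{\hbar^2}{2}d^3U-6\,U\,dU-1\Big)=0$ in $A$. In particular, if $\hbar$ is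 not a zero divisor in $A$, the zero-curvature equation is equivalent to $\frac{\hbar^2}{2}d^3U=6\,U\,dU+1$, the $t$-derivative of the Painlev\'e I equation. -/
open Polynomial

/-- Coefficientwise extension of a map `d : A → A` to the polynomial ring `A[x]`
(so `dx = 0`). -/
noncomputable def dcoef {A : Type*} [CommRing A] (d : A → A) (p : Polynomial A) :
    Polynomial A :=
  p.sum fun n a => Polynomial.C (d a) * Polynomial.X ^ n

/-- The Painlevé I Lax matrix `ℒ`. -/
noncomputable def LmatP1 {A : Type*} [CommRing A] [Algebra ℚ A] (d : A → A) (hbar U : A) :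
    Matrix (Fin 2) (Fin 2) (Polynomial A) :=
  !![(1/2 : ℚ) • (C (hbar * d U)), X - C U;
     (X - C U) * (X + 2 * C U) + (1/2 : ℚ) • (C (hbar ^ 2 * d (d U))),
     -((1/2 : ℚ) • (C (hbar * d U)))]

/-- The Painlevé I Lax matrix `ℛ`. -/
noncomputable def RmatP1 {A : Type*} [CommRing A] (U : A) :
    Matrix (Fin 2) (Fin 2) (Polynomial A) :=
  !![0, 1; X + 2 * C U, 0]

theorem dcoef_C_mul_X_pow {A : Type*} [CommRing A] {d : A → A} (hd : d 0 = 0) (a : A) (n : ℕ) :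
    dcoef d (C a * X ^ n) = C (d a) * X ^ n := by
  rw [dcoef, C_mul_X_pow_eq_monomial, sum_monomial_index _ _ (by simp [hd])]

theorem dcoef_C {A : Type*} [CommRing A] {d : A → A} (hd : d 0 = 0) (a : A) :
    dcoef d (C a) = C (d a) := by
  simpa using dcoef_C_mul_X_pow hd a 0

theorem dcoef_add {A : Type*} [CommRing A] (d : A →+ A) (p q : A[X]) :
    dcoef d (p + q) = dcoef d p + dcoef d q :=
  sum_add_index _ _ _ (by simp) (by simp [add_mul])

/-- The coefficientwise derivative of a quadratic polynomial. -/
theorem dcoef_quadratic {A : Type*} [CommRing A] (d : A →+ A) (a b c : A) :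
    dcoef d (C a * X ^ 2 + C b * X + C c) = C (d a) * X ^ 2 + C (d b) * X + C (d c) := by
  have h := dcoef_C_mul_X_pow (map_zero d) b 1
  rw [pow_one] at h
  rw [dcoef_add, dcoef_add, dcoef_C_mul_X_pow (map_zero d), h, dcoef_C (map_zero d)]

/-- The zero-curvature expression has a single possibly nonzero entry, which is constant in `x`. -/
theorem zeroCurvature_eq {A : Type*} [CommRing A] [Algebra ℚ A] (d : Derivation ℚ A A)
    (hbar : A) (hd : d hbar = 0) (U : A) :
    C hbar • (LmatP1 (fun a => d a) hbar U).map (dcoef fun a => d a)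
        - C hbar • (RmatP1 U).map derivative
        + (LmatP1 (fun a => d a) hbar U * RmatP1 U - RmatP1 U * LmatP1 (fun a => d a) hbar U)
      = !![0, 0;
          C (hbar * ((1/2 : ℚ) • (hbar ^ 2 * d (d (d U))) - 6 * U * d U - 1)), 0] := by
  have quad (a b c : A) : dcoef (fun a => d a) (C a * X ^ 2 + C b * X + C c) =
      C (d a) * X ^ 2 + C (d b) * X + C (d c) :=
    dcoef_quadratic (d : A →ₗ[ℚ] A).toAddMonoidHom a b c
  have hd2 : d (hbar ^ 2) = 0 := by simp [pow_two, hd]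
  have e11 : dcoef (fun a => d a) ((1/2 : ℚ) • C (hbar * d U)) =
      (1/2 : ℚ) • C (hbar * d (d U)) := by
    rw [smul_C, dcoef_C (map_zero d), d.map_smul, d.leibniz, hd, smul_C]
    simp
  have e22 : dcoef (fun a => d a) (-((1/2 : ℚ) • C (hbar * d U))) =
      -((1/2 : ℚ) • C (hbar * d (d U))) := by
    rw [smul_C, ← C_neg, dcoef_C (map_zero d), map_neg, d.map_smul, d.leibniz, hd, smul_C, ← C_neg]
    simp
  have e12 : dcoef (fun a => d a) (X - C U) = -C (d U) := by
    have h := quad 0 1 (-U)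
    simp only [map_zero, map_one, map_neg, d.map_one_eq_zero] at h
    rw [show (X - C U : A[X]) = 0 * X ^ 2 + 1 * X + -C U by ring, h]
    ring
  have e21 : dcoef (fun a => d a)
      ((X - C U) * (X + 2 * C U) + (1/2 : ℚ) • C (hbar ^ 2 * d (d U))) =
      C (d U) * X - 4 * C U * C (d U) + (1/2 : ℚ) • C (hbar ^ 2 * d (d (d U))) := by
    have h := quad 1 U (-(U * U) - U * U + (1/2 : ℚ) • (hbar ^ 2 * d (d U)))
    rw [smul_C, smul_C, show (X - C U) * (X + 2 * C U) + C ((1/2 : ℚ) • (hbar ^ 2 * d (d U))) =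
      C 1 * X ^ 2 + C U * X + C (-(U * U) - U * U + (1/2 : ℚ) • (hbar ^ 2 * d (d U))) by
        simp only [C_add, C_sub, C_neg, C_mul, C_1]; ring, h]
    simp only [map_add, map_sub, map_neg, d.map_smul, d.leibniz, hd2, d.map_one_eq_zero, smul_eq_mul,
      C_mul, map_zero, mul_zero, add_zero]
    ring
  have two_half : C (algebraMap ℚ A (1/2)) * 2 = (1 : A[X]) := by
    rw [← C_ofNat, ← C_mul, ← map_ofNat (algebraMap ℚ A) 2, ← map_mul]
    norm_num
  ext1 i j
  fin_cases i <;> fin_cases j <;>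
    simp only [LmatP1, RmatP1, Matrix.add_apply, Matrix.sub_apply, Matrix.smul_apply,
      Matrix.map_apply, Matrix.mul_apply, Fin.sum_univ_two, Matrix.of_apply, Matrix.cons_val',
      Matrix.cons_val_zero, Matrix.cons_val_one, Matrix.cons_val_fin_one, Fin.zero_eta, Fin.mk_one,
      Fin.isValue, e11, e12, e21, e22, smul_eq_mul, derivative_zero, derivative_one] <;>
    simp only [Algebra.smul_def, Polynomial.algebraMap_apply, C_mul, C_sub, C_pow, C_1, C_ofNat, derivative_add,
      derivative_mul, derivative_X, derivative_C, derivative_ofNat]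
  · ring
  · linear_combination (C hbar * C (d U)) * two_half
  · linear_combination (-(C hbar * C (d U) * (X + 2 * C U))) * two_half
  · ring

/-- the zero-curvature equation `ℏ dℒ - ℏ ∂ₓℛ + [ℒ,ℛ] = 0` holds iff
`ℏ ⬝ (ℏ²/2 d³U - 6 U dU - 1) = 0`; in particular, if `ℏ` is not a zero divisor,
it is equivalent to `ℏ²/2 d³U = 6 U dU + 1`. -/
theorem stmt5 {A : Type*} [CommRing A] [Algebra ℚ A] (d : Derivation ℚ A A)
    (hbar : A) (hd : d hbar = 0) (U : A) :
    ((C hbar • (LmatP1 (fun a => d a) hbar U).map (dcoef fun a => d a)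
        - C hbar • (RmatP1 U).map derivative
        + (LmatP1 (fun a => d a) hbar U * RmatP1 U - RmatP1 U * LmatP1 (fun a => d a) hbar U)
      = 0)
      ↔ hbar * ((1/2 : ℚ) • (hbar ^ 2 * d (d (d U))) - 6 * U * d U - 1) = 0)
    ∧ ((∀ a : A, hbar * a = 0 → a = 0) →
      ((C hbar • (LmatP1 (fun a => d a) hbar U).map (dcoef fun a => d a)
          - C hbar • (RmatP1 U).map derivative
          + (LmatP1 (fun a => d a) hbar U * RmatP1 U - RmatP1 U * LmatP1 (fun a => d a) hbar U)
        = 0)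
        ↔ (1/2 : ℚ) • (hbar ^ 2 * d (d (d U))) = 6 * U * d U + 1)) := by
  rw [zeroCurvature_eq d hbar hd U]
  have key : (!![0, 0; C (hbar * ((1/2 : ℚ) • (hbar ^ 2 * d (d (d U))) - 6 * U * d U - 1)), 0] :
      Matrix (Fin 2) (Fin 2) A[X]) = 0 ↔
      hbar * ((1/2 : ℚ) • (hbar ^ 2 * d (d (d U))) - 6 * U * d U - 1) = 0 := by
    constructor
    · intro h
      simpa only [Matrix.of_apply, Matrix.cons_val', Matrix.cons_val_zero, Matrix.cons_val_one,
        Matrix.cons_val_fin_one, Matrix.zero_apply, C_eq_zero] using congrFun (congrFun h 1) 0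
    · intro h
      rw [h, C_0]
      exact (Matrix.eta_fin_two 0).symm
  refine ⟨key, fun hreg => key.trans ⟨fun h => ?_, fun h => ?_⟩⟩
  · linear_combination hreg _ h
  · linear_combination hbar * h
end

section
/- Suppose the sequence $R_0,R_1,\dots\in A$ satisfies $R_0=2$ and the Gelfand–Dikii recursion $d R_{k+1}=-2U\,dR_k-R_k\,dU+\frac{\hbar^2}{4}\,d^3R_k$ for all $k\le m$. Let $\tilde t_0,\dots,\tilde t_m\in A$ with $d\tilde t_j=0$ for all $j$, and suppose the derivative of the string equation holds: $\sum_{j=0}^{m}\tilde t_j\,dR_{j+1}=1$ (i.e. $\sum_j\tilde t_j R_{j+1}=t$ with $dt=1$). Set $\mathcal L:=\sum_{j=0}^{m}\tilde t_j\,\mathcal L_j$. Then the zero-curvature equation of the Gelfand–Dikii system holds in $M_2(A[x])$: $\hbar\,d\mathcal L+\hbar\,\partial_x\mathcal R=[\mathcal R,\mathcal L]$. -/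
open Polynomial

/-- `βⱼ = (1/2) ∑_{k=0}^{j} x^{j-k} R_k`. -/
noncomputable def betaGD {A : Type*} [CommRing A] [Algebra ℚ A] (R : ℕ → A) (j : ℕ) :
    Polynomial A :=
  (1/2 : ℚ) • ∑ k ∈ Finset.range (j + 1), X ^ (j - k) * C (R k)

/-- `αⱼ = -(ℏ/2) dβⱼ`. -/
noncomputable def alphaGD {A : Type*} [CommRing A] [Algebra ℚ A]
    (d : A → A) (hbar : A) (R : ℕ → A) (j : ℕ) : Polynomial A :=
  (-(1/2 : ℚ)) • (C hbar * dcoef d (betaGD R j))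

/-- `γⱼ = (x + 2U) βⱼ + ℏ dαⱼ`. -/
noncomputable def gammaGD {A : Type*} [CommRing A] [Algebra ℚ A]
    (d : A → A) (hbar U : A) (R : ℕ → A) (j : ℕ) : Polynomial A :=
  (X + 2 * C U) * betaGD R j + C hbar * dcoef d (alphaGD d hbar R j)

/-- The Gelfand–Dikii Lax matrix `ℒⱼ`. -/
noncomputable def LmatGD {A : Type*} [CommRing A] [Algebra ℚ A]
    (d : A → A) (hbar U : A) (R : ℕ → A) (j : ℕ) :
    Matrix (Fin 2) (Fin 2) (Polynomial A) :=
  !![alphaGD d hbar R j, betaGD R j; gammaGD d hbar U R j, -alphaGD d hbar R j]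

/-- The matrix `ℛ`. -/
noncomputable def RmatGD {A : Type*} [CommRing A] (U : A) :
    Matrix (Fin 2) (Fin 2) (Polynomial A) :=
  !![0, 1; X + 2 * C U, 0]

theorem dcoef_coeff {A : Type*} [CommRing A] {d : A → A} (h0 : d 0 = 0) (p : A[X]) (n : ℕ) :
    (dcoef d p).coeff n = d (p.coeff n) := by
  rw [dcoef, Polynomial.sum, finsetSum_coeff]
  simp only [coeff_C_mul_X_pow]
  rw [Finset.sum_ite_eq]
  split_ifs with h
  · rfl
  · rw [notMem_support_iff.mp h, h0]

/-- The coefficientwise extension of a derivation of `A`, as a derivation of `A[X]`. -/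
noncomputable def coeffDerivation {A : Type*} [CommRing A] [Algebra ℚ A] (d : Derivation ℚ A A) :
    Derivation ℚ A[X] A[X] :=
  Derivation.mk'
    { toFun := dcoef fun a => d a
      map_add' := fun p q => by
        ext n
        simp [dcoef_coeff]
      map_smul' := fun r p => by
        ext n
        simp [dcoef_coeff] }
    fun p q => by
      ext n
      change (dcoef (fun a => d a) (p * q)).coeff n
        = (p * dcoef (fun a => d a) q + q * dcoef (fun a => d a) p).coeff n
      rw [mul_comm q]
      simp [dcoef_coeff, coeff_mul, Finset.sum_add_distrib, mul_comm (d _)]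

theorem dcoef_eq_coeffDerivation {A : Type*} [CommRing A] [Algebra ℚ A] (d : Derivation ℚ A A) :
    (dcoef fun a => d a) = coeffDerivation d := rfl

@[simp]
theorem coeffDerivation_C {A : Type*} [CommRing A] [Algebra ℚ A] (d : Derivation ℚ A A) (a : A) :
    coeffDerivation d (C a) = C (d a) := by
  ext n
  rw [← dcoef_eq_coeffDerivation, dcoef_coeff (map_zero d), coeff_C, coeff_C]
  split_ifs <;> simp

@[simp]
theorem coeffDerivation_X {A : Type*} [CommRing A] [Algebra ℚ A] (d : Derivation ℚ A A) :
    coeffDerivation d X = 0 := by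
  ext n
  rw [← dcoef_eq_coeffDerivation, dcoef_coeff (map_zero d), coeff_X]
  split_ifs <;> simp

theorem two_mul_algebraMap_half (B : Type*) [CommRing B] [Algebra ℚ B] :
    2 * algebraMap ℚ B (1 / 2) = 1 := by
  rw [← map_ofNat (algebraMap ℚ B) 2, ← map_mul]
  norm_num

theorem betaGD_zero {A : Type*} [CommRing A] [Algebra ℚ A] (R : ℕ → A) :
    betaGD R 0 = (1 / 2 : ℚ) • C (R 0) := by
  simp [betaGD]

theorem betaGD_succ {A : Type*} [CommRing A] [Algebra ℚ A] (R : ℕ → A) (j : ℕ) :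
    betaGD R (j + 1) = X * betaGD R j + (1 / 2 : ℚ) • C (R (j + 1)) := by
  rw [betaGD, betaGD, Finset.sum_range_succ, smul_add, mul_smul_comm, Finset.mul_sum]
  congr 2
  · refine Finset.sum_congr rfl fun k hk => ?_
    rw [Nat.succ_sub (Finset.mem_range_succ_iff.mp hk), pow_succ', mul_assoc]
  · simp

/-- The Gelfand–Dikii recursion in generating form: the operator
`2 dU + 2 (x + 2U) d - (ℏ² / 2) d³` sends `βⱼ` to `-dR_{j+1}`. -/
theorem betaGD_third_order {A : Type*} [CommRing A] [Algebra ℚ A] (d : Derivation ℚ A A)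
    (hbar U : A) (R : ℕ → A) (m : ℕ) (hR0 : d (R 0) = 0)
    (hrec : ∀ k ≤ m, d (R (k + 1))
      = -(2 * U * d (R k)) - R k * d U + (1/4 : ℚ) • (hbar ^ 2 * d (d (d (R k)))))
    {j : ℕ} (hj : j ≤ m) :
    2 * C (d U) * betaGD R j + 2 * (X + 2 * C U) * coeffDerivation d (betaGD R j)
      - (1 / 2 : ℚ) • (C hbar ^ 2
        * coeffDerivation d (coeffDerivation d (coeffDerivation d (betaGD R j))))
      = -C (d (R (j + 1))) := by
  have key : ∀ k ≤ m, C (d (R (k + 1))) = -(2 * C U * C (d (R k))) - C (R k) * C (d U)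
      + (1/4 : ℚ) • (C hbar ^ 2 * C (d (d (d (R k))))) := fun k hk => by
    rw [hrec k hk]
    simp only [map_add, map_sub, map_neg, map_mul, map_pow, ← smul_C, map_ofNat]
  have two_half := two_mul_algebraMap_half A[X]
  have quarter :
      algebraMap ℚ A[X] (1 / 4) = algebraMap ℚ A[X] (1 / 2) * algebraMap ℚ A[X] (1 / 2) := by
    rw [← map_mul]
    exact congrArg _ (by norm_num)
  induction j with
  | zero =>
    rw [key 0 hj, betaGD_zero]
    simp only [Derivation.map_smul, coeffDerivation_C, hR0, map_zero, smul_zero, mul_zero,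
      sub_zero, add_zero, mul_smul_comm, zero_sub, neg_zero]
    rw [Algebra.smul_def]
    linear_combination C (d U) * C (R 0) * two_half
  | succ j ih =>
    have ih := ih (Nat.le_of_succ_le hj)
    rw [key _ hj, betaGD_succ]
    simp only [map_add, Derivation.leibniz, Derivation.map_smul, coeffDerivation_C,
      coeffDerivation_X, smul_eq_mul, mul_zero, add_zero]
    simp only [Algebra.smul_def, quarter] at ih ⊢
    linear_combination (X : A[X]) * ih
      + (C (d U) * C (R (j + 1)) + (X + 2 * C U) * C (d (R (j + 1)))) * two_half

/-- A traceless matrix built from `b` and a derivation `D` as in the Gelfand–Dikii system satisfies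
the zero-curvature equation as soon as `b` satisfies the associated third order equation. -/
theorem zeroCurvature_of_third_order {A : Type*} [CommRing A] [Algebra ℚ A]
    (d : Derivation ℚ A A) {hbar U : A} (hd : d hbar = 0) {a b : A[X]}
    (ha : a = (-(1/2 : ℚ)) • (C hbar * coeffDerivation d b))
    (hb : 2 * C (d U) * b + 2 * (X + 2 * C U) * coeffDerivation d b
      - (1 / 2 : ℚ) • (C hbar ^ 2
        * coeffDerivation d (coeffDerivation d (coeffDerivation d b))) = -1) :
    C hbar • (!![a, b; (X + 2 * C U) * b + C hbar * coeffDerivation d a, -a]).map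
        (coeffDerivation d)
      + C hbar • (RmatGD U).map derivative
    = RmatGD U * !![a, b; (X + 2 * C U) * b + C hbar * coeffDerivation d a, -a]
      - !![a, b; (X + 2 * C U) * b + C hbar * coeffDerivation d a, -a] * RmatGD U := by
  have two_half := two_mul_algebraMap_half A[X]
  have hDtwo : coeffDerivation d (2 : A[X]) = 0 := Derivation.map_natCast _ 2
  have hD : coeffDerivation d a
      = (-(1/2 : ℚ)) • (C hbar * coeffDerivation d (coeffDerivation d b)) := by
    rw [ha]
    simp [hd]
  simp only [Algebra.smul_def, map_neg] at ha hb
  ext i j : 1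
  fin_cases i <;> fin_cases j
  · simp [RmatGD, mul_comm b]
  · simp [RmatGD]
    linear_combination 2 * ha - C hbar * coeffDerivation d b * two_half
  · simp [RmatGD, hD, hd, hDtwo]
    simp only [Algebra.smul_def]
    simp only [one_div] at ha hb two_half
    linear_combination C hbar * hb - 2 * (X + 2 * C U) * ha
      + (X + 2 * C U) * C hbar * coeffDerivation d b * two_half
  · simp [RmatGD, mul_comm b]

/-- under the Gelfand–Dikii recursion and the derivative of the
string equation `∑ⱼ t̃ⱼ dR_{j+1} = 1`, the zero-curvature equation
`ℏ dℒ + ℏ ∂ₓℛ = [ℛ, ℒ]` holds for `ℒ = ∑ⱼ t̃ⱼ ℒⱼ`. -/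
theorem stmt9 {A : Type*} [CommRing A] [Algebra ℚ A] (d : Derivation ℚ A A)
    (hbar U : A) (hd : d hbar = 0) (R : ℕ → A) (m : ℕ)
    (hR0 : R 0 = 2)
    (hrec : ∀ k ≤ m, d (R (k + 1))
      = -(2 * U * d (R k)) - R k * d U + (1/4 : ℚ) • (hbar ^ 2 * d (d (d (R k)))))
    (ttil : ℕ → A) (httil : ∀ j ≤ m, d (ttil j) = 0)
    (hstring : ∑ j ∈ Finset.range (m + 1), ttil j * d (R (j + 1)) = 1) :
    C hbar • (∑ j ∈ Finset.range (m + 1),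
        C (ttil j) • LmatGD (fun a => d a) hbar U R j).map (dcoef fun a => d a)
      + C hbar • (RmatGD U).map derivative
    = RmatGD U * (∑ j ∈ Finset.range (m + 1), C (ttil j) • LmatGD (fun a => d a) hbar U R j)
      - (∑ j ∈ Finset.range (m + 1), C (ttil j) • LmatGD (fun a => d a) hbar U R j)
        * RmatGD U := by
  set b := ∑ j ∈ Finset.range (m + 1), C (ttil j) * betaGD R j with hb
  set a := ∑ j ∈ Finset.range (m + 1), C (ttil j) * alphaGD (fun a => d a) hbar R j with ha
  have hD (p : ℕ → A[X]) :
      coeffDerivation d (∑ j ∈ Finset.range (m + 1), C (ttil j) * p j)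
        = ∑ j ∈ Finset.range (m + 1), C (ttil j) * coeffDerivation d (p j) := by
    rw [map_sum]
    refine Finset.sum_congr rfl fun j hj => ?_
    simp [httil j (Finset.mem_range_succ_iff.mp hj)]
  have hL : ∑ j ∈ Finset.range (m + 1), C (ttil j) • LmatGD (fun a => d a) hbar U R j
      = !![a, b; (X + 2 * C U) * b + C hbar * coeffDerivation d a, -a] := by
    rw [ha, hD, hb, Finset.mul_sum, Finset.mul_sum, ← Finset.sum_add_distrib]
    ext i j : 1
    rw [Matrix.sum_apply]
    fin_cases i <;> fin_cases j
    · simp [LmatGD]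
    · simp [LmatGD]
    · simp only [LmatGD, gammaGD, dcoef_eq_coeffDerivation]
      refine Finset.sum_congr rfl fun j _ => ?_
      simp
      ring
    · simp [LmatGD]
  rw [hL]
  refine zeroCurvature_of_third_order d hd ?_ ?_
  · rw [ha, hb, hD, Finset.mul_sum, Finset.smul_sum]
    refine Finset.sum_congr rfl fun j _ => ?_
    rw [alphaGD, dcoef_eq_coeffDerivation, mul_smul_comm, mul_left_comm]
  · rw [hb, hD, hD, hD]
    simp only [Finset.mul_sum, Finset.smul_sum, ← Finset.sum_add_distrib,
      ← Finset.sum_sub_distrib]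
    rw [← C_1, ← hstring, map_sum, ← Finset.sum_neg_distrib]
    refine Finset.sum_congr rfl fun j hj => ?_
    have hR : d (R 0) = 0 := by
      rw [hR0]
      exact d.map_natCast 2
    have := betaGD_third_order d hbar U R m hR hrec (Finset.mem_range_succ_iff.mp hj)
    simp only [Algebra.smul_def] at this ⊢
    rw [C_mul]
    linear_combination C (ttil j) * this
end

section
/- Assume additionally that $\mathcal L$ is differentiable and trace-free, i.e. $\mathrm{Tr}\,\mathcal L(x)=0$ for all $x$. Then for all $x\neq x'$: $\hbar^2\,\partial_x^2\mathbb K(x,x')-\frac{\hbar^2}{x-x'}\big(\partial_x\mathbb K(x,x')+\partial_{x'}\mathbb K(x,x')\big)+\det\mathcal L(x)\,\mathbb K(x,x')=\hbar\,\Psi(x')^{-1}\Big(\mathcal L'(x)-\frac{\mathcal L(x)-\mathcal L(x')}{x-x'}\Big)\Psi(x')\,\mathbb K(x,x')$. (This uses that a trace-free $2\times 2$ matrix $M$ satisfies $M^2=-\det M\cdot\mathrm{Id}$.) -/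
attribute [local instance] Matrix.normedAddCommGroup Matrix.normedSpace

/-- The kernel `𝕂(x,x') = Ψ(x')⁻¹ Ψ(x)`. -/
noncomputable def Kker (Ψ : ℝ → Matrix (Fin 2) (Fin 2) ℂ) (x x' : ℝ) :
    Matrix (Fin 2) (Fin 2) ℂ :=
  (Ψ x')⁻¹ * Ψ x

theorem hasDerivAt_matrix_mul {n : Type*} [Fintype n] [DecidableEq n]
    {A B : ℝ → Matrix n n ℂ} {A' B' : Matrix n n ℂ} {x : ℝ}
    (hA : HasDerivAt A A' x) (hB : HasDerivAt B B' x) :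
    HasDerivAt (fun s => A s * B s) (A' * B x + A x * B') x :=
  @HasDerivAt.mul ℝ _ x (Matrix n n ℂ) Matrix.linftyOpNormedRing Matrix.linftyOpNormedAlgebra
    A B A' B' hA hB

theorem hasDerivAt_ringInverse_comp {R : Type*} [NormedRing R] [NormedAlgebra ℝ R]
    [CompleteSpace R] {f : ℝ → R} {f' : R} {x : ℝ} (hf : HasDerivAt f f' x)
    (hx : IsUnit (f x)) :
    HasDerivAt (fun s => Ring.inverse (f s))
      (-(Ring.inverse (f x) * f' * Ring.inverse (f x))) x := by
  obtain ⟨u, hu⟩ := hx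
  have hinv := hasFDerivAt_ringInverse (𝕜 := ℝ) u
  rw [hu] at hinv
  rw [show Ring.inverse (f x) = ↑u⁻¹ by rw [← hu, Ring.inverse_unit]]
  exact hinv.comp_hasDerivAt x hf

theorem hasDerivAt_matrix_inv {n : Type*} [Fintype n] [DecidableEq n]
    {A : ℝ → Matrix n n ℂ} {A' : Matrix n n ℂ} {x : ℝ}
    (hA : HasDerivAt A A' x) (hx : IsUnit (A x)) :
    HasDerivAt (fun s => (A s)⁻¹) (-((A x)⁻¹ * A' * (A x)⁻¹)) x := by
  simp only [Matrix.nonsing_inv_eq_ringInverse]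
  exact @hasDerivAt_ringInverse_comp (Matrix n n ℂ) Matrix.linftyOpNormedRing
    Matrix.linftyOpNormedAlgebra (inferInstanceAs (CompleteSpace (n → n → ℂ)))
    A A' x hA hx

theorem Matrix.mul_self_of_trace_eq_zero {R : Type*} [CommRing R] {M : Matrix (Fin 2) (Fin 2) R}
    (h : M.trace = 0) : M * M = -(M.det • (1 : Matrix (Fin 2) (Fin 2) R)) := by
  rw [Matrix.trace_fin_two] at h
  ext i j
  fin_cases i <;> fin_cases j <;> simp [Matrix.mul_apply, Matrix.det_fin_two] <;> grind

/-- for a trace-free Lax matrix `ℒ`, using `ℳ² = -det ℳ · Id` for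
trace-free `2×2` matrices, one has for `x ≠ x'`:
`ℏ²∂ₓ²𝕂 - ℏ²/(x-x') (∂ₓ𝕂 + ∂ₓ'𝕂) + det ℒ(x) 𝕂
  = ℏ Ψ(x')⁻¹ (ℒ'(x) - (ℒ(x)-ℒ(x'))/(x-x')) Ψ(x') 𝕂`. -/
theorem stmt14 (hbar : ℂ) (hh : hbar ≠ 0)
    (Ψ : ℝ → Matrix (Fin 2) (Fin 2) ℂ) (hΨ : Differentiable ℝ Ψ)
    (hinv : ∀ x : ℝ, IsUnit (Ψ x))
    (L : ℝ → Matrix (Fin 2) (Fin 2) ℂ) (hL : Differentiable ℝ L)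
    (htr : ∀ x : ℝ, Matrix.trace (L x) = 0)
    (hsys : ∀ x : ℝ, hbar • deriv Ψ x = L x * Ψ x) :
    ∀ x x' : ℝ, x ≠ x' →
      hbar ^ 2 • deriv (deriv (fun s => Kker Ψ s x')) x
        - (hbar ^ 2 / ((x : ℂ) - (x' : ℂ)))
            • (deriv (fun s => Kker Ψ s x') x + deriv (fun s => Kker Ψ x s) x')
        + (L x).det • Kker Ψ x x'
      = hbar • ((Ψ x')⁻¹
          * (deriv L x - ((x : ℂ) - (x' : ℂ))⁻¹ • (L x - L x'))
          * Ψ x' * Kker Ψ x x') := by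
  intro x x' _
  have hdΨ (t : ℝ) : deriv Ψ t = hbar⁻¹ • (L t * Ψ t) := by
    rw [← hsys, inv_smul_smul₀ hh]
  have hΨ' (t : ℝ) : HasDerivAt Ψ (hbar⁻¹ • (L t * Ψ t)) t := hdΨ t ▸ (hΨ t).hasDerivAt
  have hcancel (t : ℝ) : Ψ t * (Ψ t)⁻¹ = 1 :=
    Matrix.mul_nonsing_inv _ ((Matrix.isUnit_iff_isUnit_det _).1 (hinv t))
  have hleft {F : ℝ → Matrix (Fin 2) (Fin 2) ℂ} {F' C : Matrix (Fin 2) (Fin 2) ℂ} {t : ℝ}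
      (hF : HasDerivAt F F' t) : HasDerivAt (fun s => C * F s) (C * F') t := by
    simpa using hasDerivAt_matrix_mul (hasDerivAt_const t C) hF
  have h₁ : deriv (fun s => Kker Ψ s x') =
      fun t => ((Ψ x')⁻¹ * hbar⁻¹ • (1 : Matrix (Fin 2) (Fin 2) ℂ)) * (L t * Ψ t) := by
    funext t
    exact (hleft (C := (Ψ x')⁻¹) (hΨ' t)).deriv.trans (by simp)
  have h₂ : deriv (deriv (fun s => Kker Ψ s x')) x =
      hbar⁻¹ • ((Ψ x')⁻¹ * (deriv L x * Ψ x + L x * hbar⁻¹ • (L x * Ψ x))) := by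
    rw [h₁]
    exact (hleft (C := (Ψ x')⁻¹ * hbar⁻¹ • (1 : Matrix (Fin 2) (Fin 2) ℂ))
      (hasDerivAt_matrix_mul (hL x).hasDerivAt (hΨ' x))).deriv.trans (by simp; rfl)
  have h₃ : deriv (fun s => Kker Ψ x s) x' = -(hbar⁻¹ • ((Ψ x')⁻¹ * L x' * Ψ x)) :=
    (hasDerivAt_matrix_mul (hasDerivAt_matrix_inv (hΨ' x') (hinv x'))
      (hasDerivAt_const x' (Ψ x))).deriv.trans (by simp [mul_assoc, hcancel])
  have hsq : L x * (L x * Ψ x) = -((L x).det • Ψ x) := by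
    rw [← mul_assoc, Matrix.mul_self_of_trace_eq_zero (htr x)]
    simp
  have hK : Ψ x' * ((Ψ x')⁻¹ * Ψ x) = Ψ x := by rw [← mul_assoc, hcancel, one_mul]
  rw [h₂, h₃, h₁]
  simp only [Kker, mul_assoc, hK, Matrix.mul_smul, hsq, mul_add, sub_mul, mul_sub,
    Matrix.smul_mul, one_mul, mul_neg]
  match_scalars <;> field_simp
  ring
end
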